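/- Let W ∈ ℝ^{n×n} be symmetric, ℰ a symmetric set of index pairs, and ε > 0. Let E : ℝ → ℝ^{n×n} be differentiable with E(t) symmetric and P_ℰ(E(t)) = E(t) for all t, and let λ : ℝ → ℝ and x : ℝ → ℝⁿ be differentiable with Lap(W + εE(t)) x(t) = λ(t) x(t) and ‖x(t)‖₂ = 1 for all t. Then λ̇(t) = ε ⟨G, Ė(t)⟩, where G = P_ℰ(sym(x(t)² 𝟙ᵀ) − x(t) x(t)ᵀ). -/

import Mathlib

open Matrix BigOperators

/-- The graph Laplacian `Lap(Z) = diag(Z 𝟙) - Z`. -/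
noncomputable def Lap {n : ℕ} (Z : Matrix (Fin n) (Fin n) ℝ) : Matrix (Fin n) (Fin n) ℝ :=
  Matrix.diagonal (Z.mulVec fun _ => (1 : ℝ)) - Z

/-- The Frobenius inner product `⟨X, Y⟩ = trace(Xᵀ Y)`. -/
noncomputable def finner {n : ℕ} (X Y : Matrix (Fin n) (Fin n) ℝ) : ℝ :=
  (Xᵀ * Y).trace

/-- The entrywise projection onto the sparsity pattern `S`. -/
noncomputable def proj {n : ℕ} (S : Set (Fin n × Fin n)) (A : Matrix (Fin n) (Fin n) ℝ) :
    Matrix (Fin n) (Fin n) ℝ :=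
  Matrix.of fun i j => S.indicator (fun p => A p.1 p.2) (i, j)

/-- The symmetric part `sym(A) = (A + Aᵀ)/2`. -/
noncomputable def symPart {n : ℕ} (A : Matrix (Fin n) (Fin n) ℝ) : Matrix (Fin n) (Fin n) ℝ :=
  (2 : ℝ)⁻¹ • (A + Aᵀ)

/-- Hellmann–Feynman: along a differentiable path of symmetric matrices with a differentiable
unit eigenvector, the eigenvalue has derivative `xᵀ A' x`. -/
theorem hasDerivAt_eigenvalue_eq_dotProduct {ι : Type*} [Fintype ι]
    {A : ℝ → Matrix ι ι ℝ} {A' : Matrix ι ι ℝ} {lam : ℝ → ℝ} {lam' : ℝ}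
    {x : ℝ → ι → ℝ} {x' : ι → ℝ} {t : ℝ} (hsymm : (A t).IsSymm)
    (hA : ∀ i j, HasDerivAt (fun s => A s i j) (A' i j) t)
    (hlam : HasDerivAt lam lam' t) (hx : ∀ i, HasDerivAt (fun s => x s i) (x' i) t)
    (heig : ∀ s, A s *ᵥ x s = lam s • x s) (hnorm : x t ⬝ᵥ x t = 1) :
    lam' = x t ⬝ᵥ A' *ᵥ x t := by
  have hderiv : A' *ᵥ x t + A t *ᵥ x' = lam' • x t + lam t • x' := by
    ext i
    have hleft : HasDerivAt (fun s => (A s *ᵥ x s) i) ((A' *ᵥ x t + A t *ᵥ x') i) t := by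
      simp only [mulVec, dotProduct, Pi.add_apply, ← Finset.sum_add_distrib]
      exact HasDerivAt.fun_sum fun j _ => (hA i j).mul (hx j)
    have hright : HasDerivAt (fun s => (A s *ᵥ x s) i) ((lam' • x t + lam t • x') i) t := by
      simp only [heig]
      exact hlam.mul (hx i)
    exact hleft.unique hright
  have hself : x t ⬝ᵥ A t *ᵥ x' = lam t * (x t ⬝ᵥ x') := by
    rw [dotProduct_mulVec, ← mulVec_transpose, hsymm.eq, heig, smul_dotProduct, smul_eq_mul]
  have h := congrArg (x t ⬝ᵥ ·) hderiv
  simp only [dotProduct_add, dotProduct_smul, smul_eq_mul, hnorm, hself] at h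
  linarith

theorem Lap_apply {n : ℕ} (Z : Matrix (Fin n) (Fin n) ℝ) (i j : Fin n) :
    Lap Z i j = (if i = j then ∑ k, Z i k else 0) - Z i j := by
  simp [Lap, diagonal_apply, mulVec, dotProduct]

theorem Lap_isSymm {n : ℕ} {Z : Matrix (Fin n) (Fin n) ℝ} (hZ : Z.IsSymm) : (Lap Z).IsSymm :=
  (isSymm_diagonal _).sub hZ

theorem Lap_smul {n : ℕ} (c : ℝ) (Z : Matrix (Fin n) (Fin n) ℝ) : Lap (c • Z) = c • Lap Z := by
  ext i j
  simp [Lap_apply, ← Finset.mul_sum, mul_sub]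

theorem hasDerivAt_Lap_apply {n : ℕ} {Z : ℝ → Matrix (Fin n) (Fin n) ℝ}
    {Z' : Matrix (Fin n) (Fin n) ℝ} {t : ℝ}
    (hZ : ∀ i j, HasDerivAt (fun s => Z s i j) (Z' i j) t) (i j : Fin n) :
    HasDerivAt (fun s => Lap (Z s) i j) (Lap Z' i j) t := by
  simp only [Lap_apply]
  refine HasDerivAt.fun_sub ?_ (hZ i j)
  split_ifs
  · exact HasDerivAt.fun_sum fun k _ => hZ i k
  · exact hasDerivAt_const t 0

theorem finner_eq_sum {n : ℕ} (X Y : Matrix (Fin n) (Fin n) ℝ) :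
    finner X Y = ∑ i, ∑ j, X i j * Y i j := by
  simp only [finner, trace, diag_apply, mul_apply, transpose_apply]
  exact Finset.sum_comm

theorem finner_proj_left {n : ℕ} (S : Set (Fin n × Fin n)) (X Y : Matrix (Fin n) (Fin n) ℝ) :
    finner (proj S X) Y = finner X (proj S Y) := by
  classical
  simp [finner_eq_sum, proj, Set.indicator_apply]

/-- The quadratic form of the Laplacian of a symmetric matrix, as a Frobenius inner product. -/
theorem dotProduct_Lap_mulVec {n : ℕ} {Z : Matrix (Fin n) (Fin n) ℝ} (hZ : Z.IsSymm)
    (x : Fin n → ℝ) :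
    x ⬝ᵥ Lap Z *ᵥ x =
      finner (symPart (vecMulVec (fun i => x i ^ 2) fun _ => (1 : ℝ)) - vecMulVec x x) Z := by
  have hswap : ∑ i, ∑ j, x j ^ 2 * Z i j = ∑ i, ∑ j, x i ^ 2 * Z i j := by
    rw [Finset.sum_comm]
    simp only [hZ.apply]
  have hleft : x ⬝ᵥ Lap Z *ᵥ x =
      ∑ i, ∑ j, x i ^ 2 * Z i j - ∑ i, ∑ j, x i * x j * Z i j := by
    simp only [dotProduct, mulVec, Lap_apply, sub_mul, ite_mul, zero_mul, Finset.sum_sub_distrib,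
      Finset.sum_ite_eq, Finset.mem_univ, if_true, mul_sub, ← Finset.mul_sum]
    congr 1
    · exact Finset.sum_congr rfl fun i _ => by ring
    · simp only [Finset.mul_sum]
      exact Finset.sum_congr rfl fun i _ => Finset.sum_congr rfl fun j _ => by ring
  have hright : finner (symPart (vecMulVec (fun i => x i ^ 2) fun _ => (1 : ℝ)) -
      vecMulVec x x) Z = 2⁻¹ * (∑ i, ∑ j, x i ^ 2 * Z i j + ∑ i, ∑ j, x j ^ 2 * Z i j) -
        ∑ i, ∑ j, x i * x j * Z i j := by
    simp only [finner_eq_sum, symPart, ← Finset.sum_add_distrib, Finset.mul_sum,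
      ← Finset.sum_sub_distrib]
    refine Finset.sum_congr rfl fun i _ => Finset.sum_congr rfl fun j _ => ?_
    simp only [Matrix.sub_apply, Matrix.smul_apply, Matrix.add_apply, transpose_apply,
      vecMulVec_apply, smul_eq_mul]
    ring
  rw [hleft, hright, hswap]
  ring

/-- Along a differentiable path `E(t)` of symmetric matrices with sparsity
pattern `ℰ`, if `λ(t)` is a differentiable eigenvalue of `Lap(W + ε E(t))` with differentiable
unit eigenvector `x(t)`, then `λ̇(t) = ε ⟨G, Ė(t)⟩` with
`G = P_ℰ(sym(x(t)² 𝟙ᵀ) - x(t) x(t)ᵀ)`. -/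
theorem eigenvalue_derivative_along_path {n : ℕ}
    (W : Matrix (Fin n) (Fin n) ℝ) (hW : W.IsSymm)
    (E : Set (Fin n × Fin n)) (hEsymset : ∀ i j, (i, j) ∈ E → (j, i) ∈ E)
    (ε : ℝ) (hε : 0 < ε)
    (Epath E' : ℝ → Matrix (Fin n) (Fin n) ℝ)
    (hEsym : ∀ t, (Epath t).IsSymm)
    (hEsp : ∀ t, proj E (Epath t) = Epath t)
    (hE' : ∀ t i j, HasDerivAt (fun s => Epath s i j) (E' t i j) t)
    (lam lam' : ℝ → ℝ) (x x' : ℝ → Fin n → ℝ)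
    (hlam : ∀ t, HasDerivAt lam (lam' t) t)
    (hx : ∀ t i, HasDerivAt (fun s => x s i) (x' t i) t)
    (heig : ∀ t, (Lap (W + ε • Epath t)).mulVec (x t) = lam t • x t)
    (hxnorm : ∀ t, ∑ i, x t i ^ 2 = 1) :
    ∀ t, lam' t =
      ε * finner (proj E (symPart (vecMulVec (fun i => x t i ^ 2) fun _ => (1 : ℝ)) -
        vecMulVec (x t) (x t))) (E' t) := by
  intro t
  have hsymm : (E' t).IsSymm := IsSymm.ext fun i j =>
    (hE' t j i).unique (by simpa only [(hEsym _).apply] using hE' t i j)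
  have hproj : proj E (E' t) = E' t := by
    classical
    ext i j
    by_cases hij : (i, j) ∈ E
    · simp [proj, hij]
    · have hzero : ∀ s, Epath s i j = 0 := fun s => by
        rw [← hEsp s]
        simp [proj, hij]
      have hderiv := hE' t i j
      simp only [hzero] at hderiv
      simpa [proj, hij] using (hasDerivAt_const t (0 : ℝ)).unique hderiv
  have hpath : ∀ i j, HasDerivAt (fun s => (W + ε • Epath s) i j) ((ε • E' t) i j) t :=
    fun i j => ((hE' t i j).const_mul ε).const_add (W i j)
  rw [finner_proj_left, hproj, ← dotProduct_Lap_mulVec hsymm,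
    hasDerivAt_eigenvalue_eq_dotProduct (Lap_isSymm (hW.add ((hEsym t).smul ε)))
      (hasDerivAt_Lap_apply hpath) (hlam t) (hx t) heig
      (by simpa only [dotProduct, sq] using hxnorm t),
    Lap_smul, smul_mulVec, dotProduct_smul, smul_eq_mul]
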